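/- Let D be a (unweighted) digraph and M(D) its middle digraph. Then the number of spanning trees of M(D) satisfies t(M(D)) = t(D) · Π_{i=1}^{n} (1 + d_i)^{r_i}, where d_i and r_i are respectively the outdegree and indegree of vertex v_i in D. -/

import Mathlib

open scoped Classical BigOperators

section Digraph

variable {V : Type*} [Fintype V] [DecidableEq V]

/-- `T` is a spanning in-tree (arborescence toward the root) of the digraph
with arc set containing `T`, rooted at `r`: every vertex other than `r` has
exactly one outgoing arc in `T`, the root has none, and `T` has no directed cycle. -/
def IsSpTree (T : Finset (V × V)) (r : V) : Prop :=
  (∀ v : V, v ≠ r → ∃! a : V × V, a ∈ T ∧ a.1 = v) ∧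
  (∀ a ∈ T, a.1 ≠ r) ∧
  (∀ (v : V) (l : List V), ¬ List.Chain (fun a b => (a, b) ∈ T) v (l ++ [v]))

/-- The set of spanning trees of the digraph with arc set `arcs`, rooted at `r`. -/
noncomputable def trees (arcs : Finset (V × V)) (r : V) : Finset (Finset (V × V)) :=
  arcs.powerset.filter (fun T => IsSpTree T r)

/-- Edge-weighted complexity with root `r`: `κ^{edge}(D, r, χ)`. -/
noncomputable def kappaEdgeRooted (arcs : Finset (V × V)) (χ : V × V → ℝ) (r : V) : ℝ :=
  ∑ T ∈ trees arcs r, ∏ a ∈ T, χ a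

/-- Total edge-weighted complexity `κ^{edge}(D, χ)` (over all roots). -/
noncomputable def kappaEdge (arcs : Finset (V × V)) (χ : V × V → ℝ) : ℝ :=
  ∑ r : V, kappaEdgeRooted arcs χ r

/-- Vertex-weighted complexity with root `r`: `κ^{vertex}(D, r, χ)`. -/
noncomputable def kappaVertexRooted (arcs : Finset (V × V)) (χv : V → ℝ) (r : V) : ℝ :=
  ∑ T ∈ trees arcs r, ∏ a ∈ T, χv a.2

/-- Total vertex-weighted complexity `κ^{vertex}(D, χ)` (over all roots). -/
noncomputable def kappaVertex (arcs : Finset (V × V)) (χv : V → ℝ) : ℝ :=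
  ∑ r : V, kappaVertexRooted arcs χv r

/-- Weighted adjacency matrix `W`: `W_{ij} = χ_{ij}` if `(i,j)` is an arc, else `0`. -/
def adjW (arcs : Finset (V × V)) (χ : V × V → ℝ) : Matrix V V ℝ :=
  fun i j => if (i, j) ∈ arcs then χ (i, j) else 0

/-- Edge-weighted Laplacian `Δ^{edge}`. -/
def lapEdge (arcs : Finset (V × V)) (χ : V × V → ℝ) : Matrix V V ℝ :=
  fun i j => if i = j then ∑ k ∈ Finset.univ.erase i, adjW arcs χ i k
             else - adjW arcs χ i j

/-- Vertex-weighted Laplacian `Δ^{vertex}`. -/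
noncomputable def lapVertex (arcs : Finset (V × V)) (χv : V → ℝ) : Matrix V V ℝ :=
  fun u v => if u = v then ∑ a ∈ arcs.filter (fun a => a.1 = u), χv a.2
             else if (u, v) ∈ arcs then - χv v else 0

/-- Matrix obtained by deleting the row and column indexed by `v`. -/
def minorAt (A : Matrix V V ℝ) (v : V) : Matrix {u : V // u ≠ v} {u : V // u ≠ v} ℝ :=
  A.submatrix (fun u => (u : V)) (fun u => (u : V))

/-- Out-degree of `v`. -/
def outdeg (arcs : Finset (V × V)) (v : V) : ℕ := (arcs.filter (fun a => a.1 = v)).card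

/-- In-degree of `v`. -/
def indeg (arcs : Finset (V × V)) (v : V) : ℕ := (arcs.filter (fun a => a.2 = v)).card

/-- Weighted out-degree `d_v = Σ_{t(e) = v} χ_e`. -/
noncomputable def wOut (arcs : Finset (V × V)) (χ : V × V → ℝ) (v : V) : ℝ :=
  ∑ a ∈ arcs.filter (fun a => a.1 = v), χ a

end Digraph

section MiddleDigraph

variable {V : Type*} [Fintype V] [DecidableEq V]

/-- Arc set of the middle digraph `M(D)` on the vertex set `V(D) ⊕ A(D)`:
each arc `e = (u, v)` of `D` is replaced by the directed path `u → e → v`, and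
there is an arc `e → f` whenever the head of `e` equals the tail of `f`. -/
noncomputable def midArcs (arcs : Finset (V × V)) :
    Finset ((V ⊕ {a : V × V // a ∈ arcs}) × (V ⊕ {a : V × V // a ∈ arcs})) :=
  Finset.univ.filter (fun p =>
    match p with
    | (Sum.inl u, Sum.inr e) => (e : V × V).1 = u
    | (Sum.inr e, Sum.inl v) => (e : V × V).2 = v
    | (Sum.inr e, Sum.inr f) => (e : V × V).2 = (f : V × V).1
    | _ => False)

/-- Vertex weights of `M(D)`: vertices coming from `V(D)` keep their vertex weight,
and the vertex corresponding to an arc `e` gets the arc weight `χ_e`. -/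
noncomputable def midWeight (arcs : Finset (V × V)) (χv : V → ℝ) (χ : V × V → ℝ) :
    V ⊕ {a : V × V // a ∈ arcs} → ℝ :=
  Sum.elim χv (fun e => χ (e : V × V))

end MiddleDigraph

/-- Number of spanning trees of a digraph, over all roots. -/
noncomputable def treeCount {V : Type*} [Fintype V] [DecidableEq V]
    (arcs : Finset (V × V)) : ℕ :=
  ∑ r : V, (trees arcs r).card

/-- Chains from `a` to `b` of positive length witness the transitive closure. -/
theorem exists_chain_append_singleton_iff {α : Type*} {R : α → α → Prop} {a b : α} :
    (∃ l : List α, List.IsChain R (a :: (l ++ [b]))) ↔ Relation.TransGen R a b := by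
  constructor
  · rintro ⟨l, hl⟩
    induction l generalizing a with
    | nil => cases hl with | cons_cons h _ => exact .single h
    | cons c l ih => cases hl with | cons_cons h h' => exact .head h (ih h')
  · intro h
    induction h using Relation.TransGen.head_induction_on with
    | single h => exact ⟨[], .cons_cons h (.singleton _)⟩
    | head h _ ih => exact ih.elim fun l hl => ⟨_ :: l, .cons_cons h hl⟩

/-- On a finite type, a relation has no closed chain iff its converse is well-founded. -/
theorem forall_not_chain_iff_wellFounded {α : Type*} [Finite α] {R : α → α → Prop} :
    (∀ (a : α) (l : List α), ¬ List.IsChain R (a :: (l ++ [a]))) ↔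
      WellFounded (Function.swap R) := by
  have key : (∀ (a : α) (l : List α), ¬ List.IsChain R (a :: (l ++ [a]))) ↔
      ∀ a, ¬ Relation.TransGen R a a := by
    simp only [← exists_chain_append_singleton_iff, not_exists]
  rw [key]
  constructor
  · intro h
    have : Std.Irrefl (Relation.TransGen (Function.swap R)) :=
      ⟨fun a ha => h a (Relation.transGen_swap.1 ha)⟩
    exact Subrelation.wf (r := Relation.TransGen (Function.swap R))
      (fun h => Relation.TransGen.single h) (Finite.wellFounded_of_trans_of_irrefl _)
  · intro h a ha
    exact h.transGen.irrefl.irrefl a (Relation.transGen_swap.2 ha)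

section PartialFunction

open Matrix

variable {V : Type*} [Fintype V] [DecidableEq V]

/-- The determinant of `1 - P`, for `P` the transition matrix of a partial function `f`, detects
whether every orbit of `f` terminates. -/
theorem det_one_sub_transition {R : Type*} [CommRing R] (f : V → Option V) :
    (Matrix.of fun v w => (if v = w then 1 else 0) - (if f v = some w then 1 else 0) :
      Matrix V V R).det =
      if WellFounded (fun w v => f v = some w) then 1 else 0 := by
  split_ifs with h
  · have : IsWellFounded V (fun w v => f v = some w) := ⟨h⟩
    set b : V → Ordinalᵒᵈ :=
      fun v => OrderDual.toDual (IsWellFounded.rank (fun w v => f v = some w) v)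
    have hlt : ∀ {v w}, f v = some w → b v < b w := fun {v w} hvw =>
      OrderDual.toDual_lt_toDual.2
        (IsWellFounded.rank_lt_of_rel (r := fun w v => f v = some w) hvw)
    rw [BlockTriangular.det (b := b)]
    · refine Finset.prod_eq_one fun o _ => ?_
      convert det_one (n := {v // b v = o}) (R := R)
      ext ⟨v, hv⟩ ⟨w, hw⟩
      have : f v ≠ some w := fun hvw => (hlt hvw).ne (hv.trans hw.symm)
      simp [toSquareBlock, toSquareBlockProp, one_apply, this]
    · intro v w hwv
      have h₁ : v ≠ w := by rintro rfl; exact hwv.false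
      have h₂ : f v ≠ some w := fun hvw => (hlt hvw).asymm hwv
      simp [h₁, h₂]
  · set M : Matrix V V R :=
      Matrix.of fun v w => (if v = w then 1 else 0) - (if f v = some w then 1 else 0)
    set r : V → V → Prop := fun w v => f v = some w
    set x : V → R := fun v => if Acc r v then 0 else 1
    obtain ⟨v, hv⟩ : ∃ v, ¬ Acc r v := by
      by_contra! hacc
      exact h ⟨hacc⟩
    have hx : M *ᵥ x = 0 := by
      ext u
      have hsum : (M *ᵥ x) u = x u - ∑ w, if f u = some w then x w else 0 := by
        simp [M, mulVec, dotProduct, sub_mul, Finset.sum_sub_distrib]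
      rw [hsum]
      cases hu : f u with
      | none =>
        have : Acc r u := ⟨_, fun w hw => by simp [r, hu] at hw⟩
        simp [x, this]
      | some w =>
        have : Acc r u ↔ Acc r w :=
          ⟨fun h => h.inv hu, fun h => ⟨_, fun w' hw' => by
            rw [show w' = w from Option.some_inj.1 (hw'.symm.trans hu)]; exact h⟩⟩
        simp [x, this]
    have hdet : M.det • x = 0 := by
      rw [← one_mulVec (M.det • x), mulVec_smul, ← smul_mulVec, ← adjugate_mul, ← mulVec_mulVec,
        hx, mulVec_zero]
    simpa [x, hv] using congrFun hdet v

/-- The all-minors form of the directed matrix-tree theorem: `det (diag x + L)` enumerates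
the spanning in-forests of a digraph, encoded as partial functions all of whose orbits terminate,
with weight `x` at each root. -/
theorem det_diagonal_add_laplacian {R : Type*} [CommRing R] (x : V → R) (A : V → V → R) :
    (Matrix.of fun v w => (if v = w then x v + ∑ u, A v u else 0) - A v w :
      Matrix V V R).det =
      ∑ f : V → Option V, if WellFounded (fun w v => f v = some w) then
        ∏ v, (f v).elim (x v) (A v) else 0 := by
  have hrow : (Matrix.of fun v w => (if v = w then x v + ∑ u, A v u else 0) - A v w :
      Matrix V V R) = fun v => ∑ o : Option V, o.elim (x v) (A v) •
        fun w => (if v = w then 1 else 0) - (if o = some w then 1 else 0) := by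
    ext v w
    simp [Fintype.sum_option, Finset.sum_apply, mul_sub, Finset.sum_sub_distrib]
  rw [hrow]
  change detRowAlternating.toMultilinearMap _ = _
  rw [MultilinearMap.map_sum]
  refine Finset.sum_congr rfl fun f _ => ?_
  rw [MultilinearMap.map_smul_univ]
  have := det_one_sub_transition (R := R) f
  change detRowAlternating.toMultilinearMap _ = _ at this
  erw [this]
  simp

end PartialFunction

section Trees

open DualNumber

variable {V : Type*} [Fintype V] [DecidableEq V]

/-- Spanning trees rooted at `r` as partial functions: a non-root is sent to its parent. -/
noncomputable def parentMaps (arcs : Finset (V × V)) (r : V) : Finset (V → Option V) :=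
  Finset.univ.filter fun f => (∀ v w, f v = some w → (v, w) ∈ arcs) ∧
    WellFounded (fun w v => f v = some w) ∧ ∀ v, f v = none ↔ v = r

theorem card_parentMaps (arcs : Finset (V × V)) (r : V) :
    (parentMaps arcs r).card = (trees arcs r).card := by
  set graph : (V → Option V) → Finset (V × V) :=
    fun f => Finset.univ.filter fun a => f a.1 = some a.2
  have mem_graph : ∀ {f : V → Option V} {a}, a ∈ graph f ↔ f a.1 = some a.2 := by
    simp [graph]
  have hwf : ∀ {T : Finset (V × V)} {f : V → Option V}, (∀ v w, (v, w) ∈ T ↔ f v = some w) →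
      ((∀ (v : V) (l : List V), ¬ List.IsChain (fun a b => (a, b) ∈ T) (v :: (l ++ [v]))) ↔
        WellFounded (fun w v => f v = some w)) := by
    intro T f h
    simp_rw [h]
    exact forall_not_chain_iff_wellFounded
  refine Finset.card_bij (fun f _ => graph f) ?_ ?_ ?_
  · intro f hf
    simp only [parentMaps, Finset.mem_filter, Finset.mem_univ, true_and] at hf
    obtain ⟨harc, hf_wf, hroot⟩ := hf
    rw [trees, Finset.mem_filter, Finset.mem_powerset]
    refine ⟨fun a ha => harc _ _ (mem_graph.1 ha), fun v hv => ?_, fun a ha har => ?_,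
      (hwf fun v w => mem_graph).2 hf_wf⟩
    · obtain ⟨w, hw⟩ := Option.ne_none_iff_exists'.1 (mt (hroot v).1 hv)
      refine ⟨(v, w), ⟨mem_graph.2 hw, rfl⟩, ?_⟩
      rintro ⟨v', w'⟩ ⟨ha, rfl⟩
      have := mem_graph.1 ha
      simp_all
    · simpa [mem_graph.1 ha] using (hroot a.1).2 har
  · intro f _ g _ hfg
    ext v w
    have := Finset.ext_iff.1 hfg (v, w)
    simpa [mem_graph] using this
  · intro T hT
    rw [trees, Finset.mem_filter, Finset.mem_powerset] at hT
    obtain ⟨hsub, hex, hroot, hacyc⟩ := hT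
    have hf : ∀ v, ∃ o : Option V, ∀ w, (v, w) ∈ T ↔ o = some w := by
      intro v
      by_cases hv : v = r
      · exact ⟨none, fun w => by simpa using fun h => hroot _ h hv⟩
      · obtain ⟨⟨v', w⟩, ⟨ha, rfl⟩, huniq⟩ := hex v hv
        refine ⟨some w, fun w' => ⟨fun h => ?_, fun h => ?_⟩⟩
        · simpa using (congrArg Prod.snd (huniq _ ⟨h, rfl⟩)).symm
        · rwa [← Option.some_inj.1 h]
    choose f hf using hf
    refine ⟨f, ?_, ?_⟩
    · simp only [parentMaps, Finset.mem_filter, Finset.mem_univ, true_and]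
      refine ⟨fun v w h => hsub ((hf v w).2 h), (hwf hf).1 hacyc, fun v => ⟨fun h => ?_, ?_⟩⟩
      · by_contra hv
        obtain ⟨⟨v', w⟩, ⟨ha, rfl⟩, -⟩ := hex v hv
        simpa [h] using (hf _ _).1 ha
      · rintro rfl
        refine Option.eq_none_iff_forall_ne_some.2 fun w hw => hroot _ ((hf v w).2 hw) rfl
    · ext ⟨v, w⟩
      rw [mem_graph, hf]

theorem outdeg_eq_sum (arcs : Finset (V × V)) (v : V) :
    outdeg arcs v = ∑ w, if (v, w) ∈ arcs then 1 else 0 := by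
  rw [outdeg, ← Finset.card_filter]
  refine (Finset.card_bij (fun w _ => (v, w)) ?_ ?_ ?_).symm
  · simp
  · simp
  · rintro ⟨v', w⟩ h
    obtain ⟨h, rfl⟩ := Finset.mem_filter.1 h
    exact ⟨w, by simpa using h, rfl⟩

/-- The directed matrix-tree theorem summed over all roots: to first order in `ε`,
`det (ε + L)` is `ε` times the number of spanning trees. -/
theorem det_eps_add_laplacian [Nonempty V] (arcs : Finset (V × V)) :
    (Matrix.of fun v w => (if v = w then ε + (outdeg arcs v : ℤ[ε]) else 0) -
      (if (v, w) ∈ arcs then 1 else 0) : Matrix V V ℤ[ε]).det = ε * (treeCount arcs : ℤ[ε]) := by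
  simp_rw [outdeg_eq_sum, Nat.cast_sum, Nat.cast_ite, Nat.cast_one, Nat.cast_zero]
  rw [det_diagonal_add_laplacian (fun _ => ε) fun v w => if (v, w) ∈ arcs then 1 else 0]
  have hterm : ∀ f : V → Option V, (if WellFounded (fun w v => f v = some w) then
      ∏ v, (f v).elim (ε : ℤ[ε]) (fun w => if (v, w) ∈ arcs then 1 else 0) else 0) =
      ∑ r, if f ∈ parentMaps arcs r then ε else 0 := by
    intro f
    simp only [parentMaps, Finset.mem_filter, Finset.mem_univ, true_and]
    by_cases hwf : WellFounded (fun w v => f v = some w)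
    swap
    · simp [hwf]
    by_cases harc : ∀ v w, f v = some w → (v, w) ∈ arcs
    swap
    · simp only [harc, false_and, if_false, Finset.sum_const_zero, hwf, if_true]
      push Not at harc
      obtain ⟨v, w, hvw, hnot⟩ := harc
      exact Finset.prod_eq_zero (Finset.mem_univ v) (by simp [hvw, hnot])
    obtain ⟨r, -, hr⟩ := hwf.has_min Set.univ Set.univ_nonempty
    have hr : f r = none :=
      Option.eq_none_iff_forall_ne_some.2 fun w hw => hr w trivial hw
    by_cases huniq : ∀ v, f v = none → v = r
    · have hroot : ∀ s, (∀ v, f v = none ↔ v = s) ↔ s = r := fun s =>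
        ⟨fun h => ((h r).1 hr).symm, by rintro rfl v; exact ⟨huniq v, by rintro rfl; exact hr⟩⟩
      simp only [hwf, if_true, and_iff_right harc, true_and, hroot, Finset.sum_ite_eq',
        Finset.mem_univ]
      rw [Finset.prod_eq_single r]
      · simp [hr]
      · intro v _ hv
        obtain ⟨w, hw⟩ := Option.ne_none_iff_exists'.1 (mt (huniq v) hv)
        simp [hw, harc v w hw]
      · simp
    · push Not at huniq
      obtain ⟨v, hv, hvr⟩ := huniq
      have hroot : ∀ s, ¬ ∀ v, f v = none ↔ v = s := fun s h =>
        hvr (((h v).1 hv).trans ((h r).1 hr).symm)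
      simp only [hwf, if_true, hroot, and_false, if_false, Finset.sum_const_zero]
      rw [← Finset.mul_prod_erase _ _ (Finset.mem_univ v),
        ← Finset.mul_prod_erase _ _ (Finset.mem_erase.2 ⟨hvr.symm, Finset.mem_univ r⟩)]
      simp [hv, hr, ← mul_assoc]
  rw [Finset.sum_congr rfl fun f _ => hterm f, Finset.sum_comm]
  simp [treeCount, ← card_parentMaps, Finset.mul_sum, mul_comm]

end Trees

/-- A weighted Weinstein–Aronszajn identity. -/
theorem Matrix.det_sub_mul_mul_det {m n R : Type*} [Fintype m] [Fintype n] [DecidableEq m]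
    [DecidableEq n] [CommRing R] {B : Matrix m m R} {C : Matrix n n R} {H : Matrix m n R}
    (S : Matrix n m R) (h : B * H = H * C) :
    (B - H * S).det * C.det = B.det * (C - S * H).det := by
  have key : fromBlocks B H S 1 * fromBlocks 1 0 0 C =
      fromBlocks B 0 0 1 * fromBlocks 1 H S C := by
    simp [fromBlocks_multiply, h]
  simpa [det_fromBlocks_one₂₂, det_fromBlocks_one₁₁] using congrArg det key

section Middle

open DualNumber

variable {V : Type*} [Fintype V]

/-- The tail of a vertex of the middle digraph, with `v : V` viewed as a loop at `v`. -/
def midTail (arcs : Finset (V × V)) : V ⊕ {a : V × V // a ∈ arcs} → V :=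
  Sum.elim id fun e => (e : V × V).1

/-- The head of a vertex of the middle digraph, with `v : V` viewed as a loop at `v`. -/
def midHead (arcs : Finset (V × V)) : V ⊕ {a : V × V // a ∈ arcs} → V :=
  Sum.elim id fun e => (e : V × V).2

/-- Up to loops, the middle digraph is the line digraph of `D` with a loop at each vertex. -/
theorem mem_midArcs_iff {arcs : Finset (V × V)} (hsimple : ∀ v : V, (v, v) ∉ arcs)
    (p q : V ⊕ {a : V × V // a ∈ arcs}) :
    (p, q) ∈ midArcs arcs ↔ midHead arcs p = midTail arcs q ∧ p ≠ q := by
  rw [midArcs, Finset.mem_filter]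
  rcases p with u | ⟨⟨u, v⟩, he⟩ <;> rcases q with u' | ⟨⟨u', v'⟩, hf⟩
  · simp [midHead, midTail]
  · simp [midHead, midTail, eq_comm]
  · simp [midHead, midTail]
  · simp only [midHead, midTail, Sum.elim_inr, Finset.mem_univ, true_and, iff_self_and]
    rintro rfl h
    obtain ⟨rfl, rfl⟩ := by simpa using h
    exact hsimple _ he

variable [DecidableEq V]

theorem sum_midTail (arcs : Finset (V × V)) (v : V) :
    (∑ q, if v = midTail arcs q then 1 else 0) = 1 + outdeg arcs v := by
  rw [Fintype.sum_sum_type]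
  congr 1
  · exact Fintype.sum_ite_eq v fun _ => 1
  · rw [outdeg, Finset.card_filter, ← Finset.sum_coe_sort arcs]
    exact Finset.sum_congr rfl fun e _ => if_congr eq_comm rfl rfl

theorem outdeg_midArcs {arcs : Finset (V × V)} (hsimple : ∀ v : V, (v, v) ∉ arcs)
    (p : V ⊕ {a : V × V // a ∈ arcs}) :
    outdeg (midArcs arcs) p + (if midHead arcs p = midTail arcs p then 1 else 0) =
      1 + outdeg arcs (midHead arcs p) := by
  rw [← sum_midTail, outdeg_eq_sum, ← Finset.add_sum_erase _ _ (Finset.mem_univ p),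
    ← Finset.add_sum_erase Finset.univ (fun q => if midHead arcs p = midTail arcs q then 1 else 0)
      (Finset.mem_univ p), add_comm]
  simp only [mem_midArcs_iff hsimple, ne_eq, not_true, and_false, if_false, zero_add]
  congr 1
  refine Finset.sum_congr rfl fun q hq => ?_
  simp [(Finset.ne_of_mem_erase hq).symm]

open Matrix in
/-- The Laplacians of `D` and of its middle digraph are related by the vertex-arc incidences. -/
theorem det_eps_add_laplacian_midArcs {arcs : Finset (V × V)} (hsimple : ∀ v : V, (v, v) ∉ arcs) :
    (Matrix.of fun p q => (if p = q then ε + (outdeg (midArcs arcs) p : ℤ[ε]) else 0) -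
        (if (p, q) ∈ midArcs arcs then 1 else 0) : Matrix _ _ ℤ[ε]).det *
      ∏ v, (ε + (1 + (outdeg arcs v : ℤ[ε]))) =
    (∏ p, (ε + (1 + (outdeg arcs (midHead arcs p) : ℤ[ε])))) *
      (Matrix.of fun v w => (if v = w then ε + (outdeg arcs v : ℤ[ε]) else 0) -
        (if (v, w) ∈ arcs then 1 else 0) : Matrix V V ℤ[ε]).det := by
  set c : V → ℤ[ε] := fun v => ε + (1 + (outdeg arcs v : ℤ[ε]))
  set H : Matrix (V ⊕ {a : V × V // a ∈ arcs}) V ℤ[ε] :=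
    Matrix.of fun p v => if midHead arcs p = v then 1 else 0
  set S : Matrix V (V ⊕ {a : V × V // a ∈ arcs}) ℤ[ε] :=
    Matrix.of fun v p => if midTail arcs p = v then 1 else 0
  have h : diagonal (fun p => c (midHead arcs p)) * H = H * diagonal c := by
    ext1 p v
    rw [diagonal_mul, mul_diagonal]
    by_cases hp : midHead arcs p = v <;> simp [H, hp]
  convert det_sub_mul_mul_det S h using 2
  · congr 1
    ext1 p q
    have hHS : (H * S) p q = if midHead arcs p = midTail arcs q then 1 else 0 := by
      simp [H, S, mul_apply]
    rw [Matrix.sub_apply, hHS, diagonal_apply, of_apply]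
    by_cases hpq : p = q
    · subst hpq
      have := congrArg (Nat.cast (R := ℤ[ε])) (outdeg_midArcs hsimple p)
      push_cast at this
      simp only [mem_midArcs_iff hsimple, ne_eq, not_true, and_false, if_true, if_false, c, ← this]
      ring
    · simp [mem_midArcs_iff hsimple, hpq]
  · rw [det_diagonal]
  · rw [det_diagonal]
  · congr 1
    ext1 v w
    have hSH : (S * H) v w = (if v = w then 1 else 0) + (if (v, w) ∈ arcs then 1 else 0) := by
      rw [mul_apply, Fintype.sum_sum_type]
      congr 1
      · change (∑ u, (if u = v then 1 else 0) * (if u = w then 1 else 0) : ℤ[ε]) = _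
        rw [Fintype.sum_eq_single v fun u hu => by simp [hu]]
        simp
      · have : ∀ e : {a : V × V // a ∈ arcs}, S v (Sum.inr e) * H (Sum.inr e) w =
            if (e : V × V) = (v, w) then 1 else 0 := by
          rintro ⟨⟨a, b⟩, he⟩
          by_cases ha : a = v <;> by_cases hb : b = w <;>
            simp [S, H, midHead, midTail, ha, hb]
        simp_rw [this]
        rw [Finset.sum_coe_sort arcs fun e => if e = (v, w) then (1 : ℤ[ε]) else 0]
        simp
    rw [Matrix.sub_apply, hSH, diagonal_apply, of_apply]
    by_cases hvw : v = w <;> simp [hvw, c]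
    ring

theorem prod_midHead {M : Type*} [CommMonoid M] (arcs : Finset (V × V)) (c : V → M) :
    ∏ p, c (midHead arcs p) = (∏ v, c v) * ∏ v, c v ^ indeg arcs v := by
  rw [Fintype.prod_sum_type]
  congr 1
  change ∏ e : {a : V × V // a ∈ arcs}, c (e : V × V).2 = _
  rw [Finset.prod_coe_sort arcs fun e => c e.2,
    ← Finset.prod_fiberwise_of_maps_to (t := Finset.univ) (g := Prod.snd) (by simp)]
  refine Finset.prod_congr rfl fun v _ => ?_
  rw [indeg, Finset.prod_congr rfl fun e he => by rw [(Finset.mem_filter.1 he).2],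
    Finset.prod_const]

end Middle

/-- **Unweighted corollary.** `t(M(D)) = t(D) · Π_i (1 + d_i)^{r_i}` where `d_i`, `r_i`
are the out- and in-degrees of `v_i` in `D`. -/
theorem treeCount_middle {V : Type*} [Fintype V] [DecidableEq V]
    (arcs : Finset (V × V)) (hsimple : ∀ v : V, (v, v) ∉ arcs) :
    treeCount (midArcs arcs) =
      treeCount arcs * ∏ i : V, (1 + outdeg arcs i) ^ (indeg arcs i) := by
  open DualNumber in
  cases isEmpty_or_nonempty V with
  | inl hV =>
    have : IsEmpty (V ⊕ {a : V × V // a ∈ arcs}) := by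
      rw [isEmpty_sum]
      exact ⟨hV, ⟨fun a => hV.elim a.1.1⟩⟩
    simp [treeCount]
  | inr hV =>
    have key := congrArg TrivSqZeroExt.snd (det_eps_add_laplacian_midArcs hsimple)
    rw [det_eps_add_laplacian, det_eps_add_laplacian] at key
    have hfst : ∀ {ι : Type _} [Fintype ι] (c : ι → ℕ),
        TrivSqZeroExt.fst (∏ i, (ε + (1 + (c i : ℤ[ε])))) = ((∏ i, (1 + c i) : ℕ) : ℤ) := by
      intro ι _ c
      rw [← TrivSqZeroExt.fstHom_apply ℤ, map_prod]
      simp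
    have hsnd : ∀ (x : ℤ[ε]) (n : ℕ),
        TrivSqZeroExt.snd (ε * (n : ℤ[ε]) * x) = n * TrivSqZeroExt.fst x := by
      intro x n
      simp
    have hpos : 0 < ∏ v, (1 + outdeg arcs v) := Finset.prod_pos fun v _ => by omega
    rw [mul_comm (∏ p, _), hsnd, hsnd, hfst, hfst] at key
    norm_cast at key
    rw [prod_midHead arcs fun v => 1 + outdeg arcs v] at key
    refine Nat.eq_of_mul_eq_mul_right hpos ?_
    rw [key]
    ring
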